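/- arXiv:2207.12942 — 8 statements merged into one kernel-verified Lean document; each statement's English description precedes it below -/
import Mathlib

section
/- For every d ≥ 1, the inverse of the Gray approximant G(d) equals the image of G(d) under the signed permutation that negates the d-th axis: −R(G(d)) = ω_d(G(d)), where ω_d is the map on nonzero integers with ω_d(x) = −x if |x| = d and ω_d(x) = x otherwise (applied entrywise). -/
/-- `grayInv S = −R(S)`, the reversal of `S` with every entry negated (the inverse of `S`). -/
def grayInv (S : List ℤ) : List ℤ := S.reverse.map (fun x => -x)

/-- The Gray sequence approximants: `G 0 = ⟨⟩` and `G d = ⟨G (d−1), d, −R(G (d−1))⟩`. -/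
def gray : ℕ → List ℤ
  | 0 => []
  | d + 1 => gray d ++ [((d : ℤ) + 1)] ++ grayInv (gray d)

theorem grayInv_grayInv (S : List ℤ) : grayInv (grayInv S) = S := by
  simp [grayInv]

theorem grayInv_append (S T : List ℤ) : grayInv (S ++ T) = grayInv T ++ grayInv S := by
  simp [grayInv]

theorem mem_grayInv {S : List ℤ} {x : ℤ} : x ∈ grayInv S ↔ -x ∈ S := by
  simp [grayInv, neg_eq_iff_eq_neg]

theorem natAbs_le_of_mem_gray {d : ℕ} {x : ℤ} (hx : x ∈ gray d) : x.natAbs ≤ d := by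
  induction d generalizing x with
  | zero => simp [gray] at hx
  | succ d ih =>
    simp only [gray, List.mem_append, List.mem_singleton, mem_grayInv] at hx
    rcases hx with (hx | rfl) | hx
    · exact (ih hx).trans d.le_succ
    · omega
    · have := ih hx
      omega

/-- Negating the entries of absolute value `n` fixes a list whose entries are all smaller. -/
theorem map_negate_eq_self {n : ℕ} {S : List ℤ} (hS : ∀ x ∈ S, x.natAbs < n) :
    S.map (fun x => if x.natAbs = n then -x else x) = S := by
  conv_rhs => rw [← List.map_id S]
  exact List.map_congr_left fun x hx => if_neg (hS x hx).ne

/-- For every `d ≥ 1`, the inverse of the Gray approximant `G(d)` equals the image of `G(d)`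
under the signed permutation that negates the `d`-th axis. -/
theorem gray_inv_eq_negate_last (d : ℕ) (hd : 1 ≤ d) :
    grayInv (gray d) = (gray d).map (fun x => if x.natAbs = d then -x else x) := by
  obtain ⟨d, rfl⟩ := Nat.exists_eq_add_of_le' hd
  have hlt : ∀ x ∈ gray d, x.natAbs < d + 1 := fun x hx =>
    Nat.lt_succ_of_le (natAbs_le_of_mem_gray hx)
  have hlt_inv : ∀ x ∈ grayInv (gray d), x.natAbs < d + 1 := fun x hx => by
    simpa using hlt (-x) (mem_grayInv.mp hx)
  have hlast : ((d : ℤ) + 1).natAbs = d + 1 := by omega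
  simp only [gray, grayInv_append, grayInv_grayInv, List.map_append, map_negate_eq_self hlt,
    map_negate_eq_self hlt_inv]
  simp [grayInv, hlast]
end

section
/- For every d ≥ 1 and every k with 0 ≤ k ≤ d−1, every contiguous sublist of length 2^k of the Gray approximant G(d) contains entries with exactly k+1 distinct absolute values (i.e., any 2^k subsequent edges of the Gray curve use exactly k+1 coordinate directions, so they span a (k+1)-dimensional unit cube). -/
theorem padicValNat_two_pow_mul_odd (j t : ℕ) : padicValNat 2 (2 ^ j * (2 * t + 1)) = j := by
  rw [padicValNat.mul (by positivity) (by omega), padicValNat.prime_pow,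
    padicValNat.eq_zero_of_not_dvd (by omega), add_zero]

theorem exists_eq_two_pow_mul_odd_of_pos {x : ℕ} (hx : 0 < x) :
    ∃ j t, x = 2 ^ j * (2 * t + 1) := by
  obtain ⟨j, m, ⟨t, rfl⟩, h⟩ := Nat.exists_eq_two_pow_mul_odd hx.ne'
  exact ⟨j, t, h⟩

/-- The 2-adic valuation is symmetric about the midpoint of `(0, 2 ^ d)`. -/
theorem padicValNat_two_pow_sub {d x : ℕ} (hx : 0 < x) (hxd : x < 2 ^ d) :
    padicValNat 2 (2 ^ d - x) = padicValNat 2 x := by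
  obtain ⟨j, t, rfl⟩ := exists_eq_two_pow_mul_odd_of_pos hx
  have hj : j < d := (Nat.pow_lt_pow_iff_right (by norm_num)).1
    ((Nat.le_mul_of_pos_right _ (by omega)).trans_lt hxd)
  obtain ⟨e, rfl⟩ := Nat.exists_eq_add_of_lt hj
  have hpow : 2 ^ (j + e + 1) = 2 ^ j * (2 * 2 ^ e) := by ring
  rw [hpow] at hxd ⊢
  have hlt : 2 * t + 1 < 2 * 2 ^ e := Nat.lt_of_mul_lt_mul_left hxd
  rw [← Nat.mul_sub,
    show 2 * 2 ^ e - (2 * t + 1) = 2 * (2 ^ e - t - 1) + 1 by omega]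
  simp only [padicValNat_two_pow_mul_odd]

theorem gray_length (d : ℕ) : (gray d).length + 1 = 2 ^ d := by
  induction d with
  | zero => simp [gray]
  | succ d ih =>
    simp only [gray, grayInv, List.length_append, List.length_map, List.length_reverse,
      List.length_singleton]
    rw [pow_succ]
    omega

/-- The absolute value of the `i`-th entry (counted from zero) is one more than the 2-adic
valuation of `i + 1`. -/
theorem natAbs_gray_getElem (d : ℕ) : ∀ (i : ℕ) (h : i < (gray d).length),
    ((gray d)[i]).natAbs = padicValNat 2 (i + 1) + 1 := by
  induction d with
  | zero => intro i h; simp [gray] at h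
  | succ d ih =>
    intro i h
    have hlen := gray_length d
    have hlen' := gray_length (d + 1)
    have hpow : 2 ^ (d + 1) = 2 * 2 ^ d := by ring
    simp only [gray, grayInv, List.append_assoc]
    rcases lt_trichotomy i (gray d).length with hi | hi | hi
    · rw [List.getElem_append_left hi]
      exact ih i hi
    · subst hi
      rw [List.getElem_append_right le_rfl, hlen, padicValNat.prime_pow]
      simp
      omega
    · have hi' : (gray d).length - 1 - (i - (gray d).length - 1) < (gray d).length := by omega
      rw [List.getElem_append_right hi.le, List.getElem_append_right (by simp; omega)]
      simp only [List.getElem_map, List.getElem_reverse, List.length_singleton, Int.natAbs_neg]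
      rw [ih _ hi', ← padicValNat_two_pow_sub (d := d + 1) (x := i + 1) (by omega) (by omega)]
      congr 2
      omega

/-- Among `2 ^ k` consecutive positive integers, the 2-adic valuation takes exactly `k + 1`
values. -/
theorem card_image_padicValNat_two (k s : ℕ) :
    ((Finset.range (2 ^ k)).image fun i => padicValNat 2 (s + i + 1) + 1).card = k + 1 := by
  have key : ∀ n r : ℕ, r < n → ∃ i < n, (s + i + 1) % n = r := by
    intro n r hr
    have hn : 0 < n := by omega
    refine ⟨(r + n * (s + 1) - (s + 1)) % n, Nat.mod_lt _ hn, ?_⟩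
    have hle : s + 1 ≤ n * (s + 1) := Nat.le_mul_of_pos_left _ hn
    rw [show s + (r + n * (s + 1) - (s + 1)) % n + 1
      = (s + 1) + (r + n * (s + 1) - (s + 1)) % n by omega, Nat.add_mod_mod,
      show s + 1 + (r + n * (s + 1) - (s + 1)) = r + n * (s + 1) by omega,
      Nat.add_mul_mod_self_left, Nat.mod_eq_of_lt hr]
  obtain ⟨m, hm, hmod⟩ := key (2 ^ k) 0 (by positivity)
  have hdvd : 2 ^ k ∣ s + m + 1 := Nat.dvd_of_mod_eq_zero hmod
  have hle : k ≤ padicValNat 2 (s + m + 1) :=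
    (padicValNat_dvd_iff_le (by omega)).1 hdvd
  have himage : ((Finset.range (2 ^ k)).image fun i => padicValNat 2 (s + i + 1) + 1)
      = insert (padicValNat 2 (s + m + 1) + 1) ((Finset.range k).image (· + 1)) := by
    ext v
    simp only [Finset.mem_image, Finset.mem_range, Finset.mem_insert]
    constructor
    · rintro ⟨i, hi, rfl⟩
      by_cases hk : padicValNat 2 (s + i + 1) < k
      · exact .inr ⟨_, hk, rfl⟩
      · have hdvd' : 2 ^ k ∣ s + i + 1 :=
          (padicValNat_dvd_iff_le (by omega)).2 (not_lt.1 hk)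
        have hmodeq : s + 1 + i ≡ s + 1 + m [MOD 2 ^ k] := by
          rw [show s + 1 + i = s + i + 1 by omega, show s + 1 + m = s + m + 1 by omega]
          exact (Nat.modEq_zero_iff_dvd.2 hdvd').trans (Nat.modEq_zero_iff_dvd.2 hdvd).symm
        have him : i = m := (Nat.ModEq.add_left_cancel' _ hmodeq).eq_of_lt_of_lt hi hm
        exact .inl (by rw [him])
    · rintro (rfl | ⟨j, hj, rfl⟩)
      · exact ⟨m, hm, rfl⟩
      · have hpow : 2 ^ (j + 1) = 2 ^ j * 2 := pow_succ 2 j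
        obtain ⟨i, hi, hir⟩ := key (2 ^ (j + 1)) (2 ^ j) (Nat.pow_lt_pow_right (by norm_num)
          (by omega))
        refine ⟨i, hi.trans_le (Nat.pow_le_pow_right (by norm_num) hj), ?_⟩
        have hdiv := Nat.div_add_mod (s + i + 1) (2 ^ (j + 1))
        rw [hir] at hdiv
        rw [← hdiv, show 2 ^ (j + 1) * ((s + i + 1) / 2 ^ (j + 1)) + 2 ^ j
          = 2 ^ j * (2 * ((s + i + 1) / 2 ^ (j + 1)) + 1) by ring, padicValNat_two_pow_mul_odd]
  rw [himage, Finset.card_insert_of_notMem, Finset.card_image_of_injective _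
    (add_left_injective 1), Finset.card_range]
  simp only [Finset.mem_image, Finset.mem_range, not_exists, not_and]
  omega

/-- For every `d ≥ 1` and every `0 ≤ k ≤ d−1`, every contiguous sublist of length `2^k`
of the Gray approximant `G(d)` contains entries with exactly `k+1` distinct absolute values. -/
theorem gray_infix_spans (d k : ℕ) (hd : 1 ≤ d) (hk : k ≤ d - 1) :
    ∀ L : List ℤ, L <:+: gray d → L.length = 2 ^ k →
      ((L.map Int.natAbs).toFinset).card = k + 1 := by
  rintro L ⟨A, B, hAB⟩ hL
  rw [← card_image_padicValNat_two k A.length]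
  congr 1
  have hentry : ∀ (i : ℕ) (hi : i < L.length),
      (L[i]).natAbs = padicValNat 2 (A.length + i + 1) + 1 := by
    intro i hi
    have hlen : A.length + i < (gray d).length := by
      rw [← hAB]; simp only [List.length_append]; omega
    rw [← natAbs_gray_getElem d _ hlen]
    simp [← hAB, List.getElem_append_left hi]
  ext v
  simp only [List.mem_toFinset, List.mem_map, Finset.mem_image, Finset.mem_range, ← hL]
  constructor
  · rintro ⟨x, hx, rfl⟩
    obtain ⟨i, hi, rfl⟩ := List.getElem_of_mem hx
    exact ⟨i, hi, (hentry i hi).symm⟩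
  · rintro ⟨i, hi, rfl⟩
    exact ⟨L[i], List.getElem_mem hi, hentry i hi⟩
end

section
/- The uniform substitution T₁ of length 2 generates the Gray sequence: let T₁ map a nonzero integer x to the two-element list ⟨1, x + sgn(x)⟩ if |x| = 1 and to ⟨−1, x + sgn(x)⟩ if |x| ≠ 1. Then for every d ≥ 1, applying T₁ entrywise to G(d) and concatenating the images, followed by appending a final entry −1, yields G(d+1); that is, G(d+1) = ⟨T₁(g_1), T₁(g_2), …, T₁(g_{2^d−1}), −1⟩ where g_1,…,g_{2^d−1} are the entries of G(d). -/
/-- The uniform substitution `T₁` of length `2`: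
`T₁ x = ⟨1, x + sgn x⟩` if `|x| = 1` and `T₁ x = ⟨−1, x + sgn x⟩` otherwise. -/
def graySubstT1 (x : ℤ) : List ℤ :=
  if x.natAbs = 1 then [1, x + Int.sign x] else [-1, x + Int.sign x]

theorem graySubstT1_of_two_le {x : ℤ} (hx : 2 ≤ x) : graySubstT1 x = [-1, x + 1] := by
  rw [graySubstT1, if_neg (by omega), Int.sign_eq_one_of_pos (by omega)]

theorem graySubstT1_neg_of_two_le {x : ℤ} (hx : 2 ≤ x) : graySubstT1 (-x) = [-1, -(x + 1)] := by
  rw [graySubstT1, if_neg (by omega), Int.sign_eq_neg_one_of_neg (by omega), neg_add]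

/-- Up to a trailing `-1`, the substitution `T₁` commutes with inversion of `G (d + 1)`. -/
theorem flatMap_graySubstT1_grayInv_gray (d : ℕ) :
    (grayInv (gray (d + 1))).flatMap graySubstT1 ++ [-1] =
      grayInv ((gray (d + 1)).flatMap graySubstT1 ++ [-1]) := by
  induction d with
  | zero => decide
  | succ d ih =>
    have hd : (2 : ℤ) ≤ ((d + 1 : ℕ) : ℤ) + 1 := by omega
    rw [gray]
    generalize gray (d + 1) = S at ih ⊢
    generalize ((d + 1 : ℕ) : ℤ) + 1 = x at hd ⊢
    have ih' := congrArg grayInv ih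
    rw [grayInv_grayInv] at ih'
    have hsingle : grayInv [x] = [-x] := rfl
    have hpair : grayInv [-1, x + 1] = [-(x + 1), 1] := rfl
    have hone : grayInv [-1] = [1] := rfl
    simp only [grayInv_append, grayInv_grayInv, List.flatMap_append, List.flatMap_singleton, hsingle,
      hpair, hone, graySubstT1_of_two_le hd, graySubstT1_neg_of_two_le hd] at ih ih' ⊢
    simp only [List.append_assoc, ih]
    rw [← List.append_assoc [1], ih']
    simp

/-- The uniform substitution `T₁` generates the Gray sequence: for every `d ≥ 1`,
`G(d+1) = ⟨T₁(g₁), …, T₁(g_{2^d−1}), −1⟩` where `g₁, …, g_{2^d−1}` are the entries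
of `G(d)`. -/
theorem gray_substT1 (d : ℕ) (hd : 1 ≤ d) :
    gray (d + 1) = (gray d).flatMap graySubstT1 ++ [-1] := by
  induction d, hd using Nat.le_induction with
  | base => decide
  | succ d hd ih =>
    obtain ⟨d, rfl⟩ := Nat.exists_eq_add_of_le' hd
    have hx : (2 : ℤ) ≤ ((d + 1 : ℕ) : ℤ) + 1 := by omega
    conv_rhs => rw [gray]
    rw [gray, ih, ← flatMap_graySubstT1_grayInv_gray]
    simp only [List.flatMap_append, List.flatMap_singleton, graySubstT1_of_two_le hx]
    simp
    ring
end

section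
/- The non-uniform substitution T₂ generates the Gray sequence: let T₂ map 1 to ⟨1, 2, −1⟩, map −1 to −R(⟨1, 2, −1⟩) = ⟨1, −2, −1⟩, and map every nonzero integer x with |x| ≠ 1 to the single-entry list ⟨x + sgn(x)⟩. Then for every d ≥ 1, applying T₂ entrywise to G(d) and concatenating the images yields G(d+1). -/
/-- The non-uniform substitution `T₂`: `T₂ 1 = ⟨1, 2, −1⟩`, `T₂ (−1) = ⟨1, −2, −1⟩`,
and `T₂ x = ⟨x + sgn x⟩` for `|x| ≠ 1`. -/
def graySubstT2 (x : ℤ) : List ℤ :=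
  if x = 1 then [1, 2, -1]
  else if x = -1 then [1, -2, -1]
  else [x + Int.sign x]

theorem grayInv_cons (x : ℤ) (S : List ℤ) : grayInv (x :: S) = grayInv S ++ [-x] := by
  simp [grayInv]

theorem graySubstT2_neg (x : ℤ) : graySubstT2 (-x) = grayInv (graySubstT2 x) := by
  by_cases h₁ : x = 1
  · subst h₁; decide
  by_cases h₂ : x = -1
  · subst h₂; decide
  have h₃ : -x ≠ 1 := by lia
  simp [graySubstT2, grayInv, h₁, h₂, h₃, Int.sign_neg, add_comm]

theorem flatMap_graySubstT2_grayInv (S : List ℤ) :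
    (grayInv S).flatMap graySubstT2 = grayInv (S.flatMap graySubstT2) := by
  induction S with
  | nil => rfl
  | cons x S ih =>
    simp [grayInv_cons, grayInv_append, List.flatMap_append, ih, graySubstT2_neg]

theorem graySubstT2_of_one_lt {x : ℤ} (hx : 1 < x) : graySubstT2 x = [x + 1] := by
  have h₁ : x ≠ 1 := by lia
  have h₂ : x ≠ -1 := by lia
  simp [graySubstT2, h₁, h₂, Int.sign_eq_one_of_pos (by lia : 0 < x)]

/-- The non-uniform substitution `T₂` generates the Gray sequence: for every `d ≥ 1`,
applying `T₂` entrywise to `G(d)` and concatenating the images yields `G(d+1)`. -/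
theorem gray_substT2 (d : ℕ) (hd : 1 ≤ d) :
    gray (d + 1) = (gray d).flatMap graySubstT2 := by
  induction d, hd using Nat.le_induction with
  | base => decide
  | succ d hd ih =>
    have hT : graySubstT2 ((d : ℤ) + 1) = [((d + 1 : ℕ) : ℤ) + 1] := by
      rw [graySubstT2_of_one_lt (by lia)]
      push_cast
      rfl
    conv_lhs => rw [gray, ih]
    conv_rhs => rw [gray]
    simp only [List.flatMap_append, List.flatMap_singleton, flatMap_graySubstT2_grayInv, hT]
end

section
/- For every n ≥ 1, the uniform substitution T_n of length 2^n generates the Gray sequence: let T_n map a nonzero integer x to the list ⟨G(n), x + n·sgn(x)⟩ (G(n) followed by the single entry x + n·sgn(x)) if |x| = 1, and to ⟨−R(G(n)), x + n·sgn(x)⟩ if |x| ≠ 1. Then for every d ≥ 1, applying T_n entrywise to G(d), concatenating the images, and appending −R(G(n)) yields G(d+n). -/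
/-- The uniform substitution `T_n` of length `2^n`:
`T_n x = ⟨G(n), x + n·sgn x⟩` if `|x| = 1` and `T_n x = ⟨−R(G(n)), x + n·sgn x⟩`
otherwise. -/
def graySubstTn (n : ℕ) (x : ℤ) : List ℤ :=
  if x.natAbs = 1 then gray n ++ [x + (n : ℤ) * Int.sign x]
  else grayInv (gray n) ++ [x + (n : ℤ) * Int.sign x]

theorem grayInv_singleton (x : ℤ) : grayInv [x] = [-x] := rfl

theorem grayInv_gray_succ (d : ℕ) :
    grayInv (gray (d + 1)) = gray d ++ [-((d : ℤ) + 1)] ++ grayInv (gray d) := by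
  simp only [gray, grayInv_append, grayInv_singleton, grayInv_grayInv, List.append_assoc]

theorem graySubstTn_one (n : ℕ) : graySubstTn n 1 = gray n ++ [(n : ℤ) + 1] := by
  simp [graySubstTn, add_comm]

theorem graySubstTn_neg_one (n : ℕ) : graySubstTn n (-1) = gray n ++ [-((n : ℤ) + 1)] := by
  simp [graySubstTn]

theorem graySubstTn_natCast (n : ℕ) {m : ℕ} (hm : 2 ≤ m) :
    graySubstTn n m = grayInv (gray n) ++ [(m : ℤ) + n] := by
  have hs : Int.sign (m : ℤ) = 1 := Int.sign_eq_one_of_pos (by omega)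
  rw [graySubstTn, if_neg (by omega), hs, mul_one]

theorem graySubstTn_neg_natCast (n : ℕ) {m : ℕ} (hm : 2 ≤ m) :
    graySubstTn n (-m) = grayInv (gray n) ++ [-((m : ℤ) + n)] := by
  have hs : Int.sign (-(m : ℤ)) = -1 := Int.sign_eq_neg_one_of_neg (by omega)
  rw [graySubstTn, if_neg (by omega), hs]
  congr 2
  ring

/-- The substitution identity for `gray d`, together with its counterpart for the inverse list. -/
theorem gray_add_and_grayInv_gray_add (n d : ℕ) (hd : 1 ≤ d) :
    gray (d + n) = (gray d).flatMap (graySubstTn n) ++ grayInv (gray n) ∧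
      grayInv (gray (d + n)) =
        (grayInv (gray d)).flatMap (graySubstTn n) ++ grayInv (gray n) := by
  induction d, hd using Nat.le_induction with
  | base =>
    rw [add_comm 1 n, grayInv_gray_succ]
    constructor <;> simp [gray, grayInv, graySubstTn_one, graySubstTn_neg_one]
  | succ d hd ih =>
    obtain ⟨h, h'⟩ := ih
    have hpos := graySubstTn_natCast n (m := d + 1) (by omega)
    have hneg := graySubstTn_neg_natCast n (m := d + 1) (by omega)
    simp only [Nat.cast_add, Nat.cast_one] at hpos hneg
    have hc : ((d + n : ℕ) : ℤ) + 1 = d + 1 + n := by push_cast; ring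
    rw [Nat.add_right_comm d 1 n, grayInv_gray_succ, grayInv_gray_succ, gray, gray, hc, h', h]
    simp only [List.flatMap_append, List.flatMap_singleton, hpos, hneg, List.append_assoc,
      and_self]

/-- For every `n ≥ 1`, the uniform substitution `T_n` generates the Gray sequence:
for every `d ≥ 1`, applying `T_n` entrywise to `G(d)`, concatenating the images, and
appending `−R(G(n))` yields `G(d+n)`. -/
theorem gray_substTn (n : ℕ) (hn : 1 ≤ n) (d : ℕ) (hd : 1 ≤ d) :
    gray (d + n) = (gray d).flatMap (graySubstTn n) ++ grayInv (gray n) := by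
  exact (gray_add_and_grayInv_gray_add n d hd).1
end

section
/- For every d ≥ 1, the Gray approximant G(d) is a normalized sequence: for every k with 1 ≤ k ≤ d, the first entry of G(d) whose absolute value equals k is the positive entry +k, and every entry occurring before it has absolute value strictly less than k. -/
theorem gray_prefix_gray {m d : ℕ} (h : m ≤ d) : gray m <+: gray d := by
  induction d, h using Nat.le_induction with
  | base => exact List.prefix_refl _
  | succ d _ ih =>
    refine ih.trans ?_
    rw [gray, List.append_assoc]
    exact List.prefix_append _ _

/-- For every `d ≥ 1`, the Gray approximant `G(d)` is normalized: for every `1 ≤ k ≤ d`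
there is an index `i` whose entry is the positive value `+k`, all earlier entries having
absolute value strictly less than `k` (so the first entry of absolute value `k` is `+k`). -/
theorem gray_normalized (d : ℕ) (hd : 1 ≤ d) (k : ℕ) (hk1 : 1 ≤ k) (hk2 : k ≤ d) :
    ∃ i : ℕ, ∃ hi : i < (gray d).length,
      (gray d)[i]'hi = (k : ℤ) ∧
      ∀ j : ℕ, ∀ hj : j < i, ((gray d)[j]'(hj.trans hi)).natAbs < k := by
  obtain ⟨m, rfl⟩ := Nat.exists_eq_add_of_le' hk1
  obtain ⟨t, ht⟩ := gray_prefix_gray hk2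
  have hsplit : gray d = gray m ++ ((m : ℤ) + 1) :: (grayInv (gray m) ++ t) := by
    simp [← ht, gray]
  refine ⟨(gray m).length, by simp [hsplit], by simp [hsplit], fun j hj => ?_⟩
  have hget : (gray d)[j]'(hj.trans (by simp [hsplit])) = (gray m)[j] := by
    simp [hsplit, List.getElem_append_left hj]
  rw [hget]
  exact Nat.lt_succ_of_le (natAbs_le_of_mem_gray (List.getElem_mem hj))
end

section
/- For every d ≥ 2 and every m ≥ 1, the chain of m copies of the Gray approximant G(d) mutually connected by the single edge ⟨d⟩ — that is, the list C = G(d) ++ ⟨d⟩ ++ G(d) ++ ⟨d⟩ ++ … ++ ⟨d⟩ ++ G(d) with m copies of G(d) — is (d−1)-hyper-orthogonal: for every k with 1 ≤ k ≤ d−1, every contiguous sublist of C of length 2^k contains entries with exactly k+1 distinct absolute values. -/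
/-- A list of nonzero integers is `n`-hyper-orthogonal if for every `k = 1,…,n`, every
contiguous sublist of length `2^k` contains entries with exactly `k+1` distinct
absolute values. -/
def HyperOrthogonal (n : ℕ) (S : List ℤ) : Prop :=
  ∀ k : ℕ, 1 ≤ k → k ≤ n → ∀ L : List ℤ, L <:+: S → L.length = 2 ^ k →
    ((L.map Int.natAbs).toFinset).card = k + 1

/-- The capped ruler function: the absolute value of the `i`-th entry (counted from `1`) of a
chain of copies of `gray d` connected by `d`. -/
def cappedRuler (d i : ℕ) : ℕ := min (padicValNat 2 i + 1) d

theorem padicValNat_two_lt_iff {i d : ℕ} (hi : i ≠ 0) :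
    padicValNat 2 i < d ↔ ¬ 2 ^ d ∣ i := by
  rw [padicValNat_dvd_iff_le hi, not_le]

theorem padicValNat_two_eq_iff {i j : ℕ} (hi : i ≠ 0) :
    padicValNat 2 i = j ↔ 2 ^ j ∣ i ∧ ¬ 2 ^ (j + 1) ∣ i := by
  rw [padicValNat_dvd_iff_le hi, padicValNat_dvd_iff_le hi]
  omega

theorem cappedRuler_of_not_dvd {d k i : ℕ} (hk : k ≤ d) (h : ¬ 2 ^ k ∣ i) :
    cappedRuler d i = padicValNat 2 i + 1 ∧ padicValNat 2 i < k := by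
  have hi : i ≠ 0 := by rintro rfl; simp at h
  have := (padicValNat_two_lt_iff hi).2 h
  exact ⟨min_eq_left (by omega), this⟩

theorem cappedRuler_of_dvd {d k i : ℕ} (hi : i ≠ 0) (hk : k < d) (h : 2 ^ k ∣ i) :
    k < cappedRuler d i := by
  have := (padicValNat_dvd_iff_le hi).1 h
  exact lt_min (by omega) hk

theorem cappedRuler_add_two_pow {d i : ℕ} (hi : ¬ 2 ^ d ∣ i) (c : ℕ) :
    cappedRuler d (2 ^ d * c + i) = cappedRuler d i := by
  have hi0 : i ≠ 0 := by rintro rfl; simp at hi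
  have hci : ¬ 2 ^ d ∣ 2 ^ d * c + i := by rwa [Nat.dvd_add_right (dvd_mul_right _ _)]
  obtain ⟨h₁, hlt⟩ := cappedRuler_of_not_dvd le_rfl hi
  rw [h₁, (cappedRuler_of_not_dvd le_rfl hci).1, Nat.add_right_cancel_iff,
    padicValNat_two_eq_iff (by omega)]
  obtain ⟨h₂, h₃⟩ := (padicValNat_two_eq_iff hi0).1 rfl
  rw [Nat.dvd_add_right (dvd_mul_of_dvd_left (pow_dvd_pow 2 hlt.le) c),
    Nat.dvd_add_right (dvd_mul_of_dvd_left (pow_dvd_pow 2 hlt) c)]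
  exact ⟨h₂, h₃⟩

theorem map_natAbs_grayInv (S : List ℤ) :
    (grayInv S).map Int.natAbs = (S.map Int.natAbs).reverse := by
  simp [grayInv, Function.comp_def]

theorem reverse_map_natAbs_gray (d : ℕ) :
    ((gray d).map Int.natAbs).reverse = (gray d).map Int.natAbs := by
  cases d with
  | zero => rfl
  | succ d => simp [gray, map_natAbs_grayInv]

theorem map_natAbs_gray_succ (d : ℕ) :
    (gray (d + 1)).map Int.natAbs =
      (gray d).map Int.natAbs ++ [d + 1] ++ (gray d).map Int.natAbs := by
  rw [gray, List.map_append, List.map_append, map_natAbs_grayInv, reverse_map_natAbs_gray]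
  simp only [List.map_cons, List.map_nil]
  congr 3

theorem map_natAbs_gray (d : ℕ) :
    (gray d).map Int.natAbs =
      (List.range (2 ^ d - 1)).map fun i => padicValNat 2 (i + 1) + 1 := by
  induction d with
  | zero => rfl
  | succ d ih =>
    have hpos : 0 < 2 ^ d := by positivity
    have hN : 2 ^ (d + 1) - 1 = (2 ^ d - 1) + 1 + (2 ^ d - 1) := by rw [pow_succ]; omega
    rw [map_natAbs_gray_succ, ih, hN, List.range_add, List.range_add]
    simp only [List.map_append, List.map_map]
    congr 1
    · simp [Nat.sub_add_cancel hpos]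
    · refine List.map_congr_left fun i hi => ?_
      rw [List.mem_range] at hi
      have hnd : ¬ 2 ^ d ∣ i + 1 := Nat.not_dvd_of_pos_of_lt (by omega) (by omega)
      have hnd' : ¬ 2 ^ d ∣ 2 ^ d * 1 + (i + 1) := by rwa [Nat.dvd_add_right (dvd_mul_right _ _)]
      have h := cappedRuler_add_two_pow hnd 1
      rw [(cappedRuler_of_not_dvd le_rfl hnd).1, (cappedRuler_of_not_dvd le_rfl hnd').1] at h
      rw [← h, Function.comp_apply]
      congr 2
      omega

theorem map_natAbs_gray_eq_cappedRuler (d : ℕ) :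
    (gray d).map Int.natAbs = (List.range (2 ^ d - 1)).map fun i => cappedRuler d (i + 1) := by
  rw [map_natAbs_gray]
  refine List.map_congr_left fun i hi => ?_
  rw [List.mem_range] at hi
  exact (cappedRuler_of_not_dvd le_rfl
    (Nat.not_dvd_of_pos_of_lt (by omega) (by omega))).1.symm

theorem cappedRuler_two_pow_mul {d c : ℕ} (hc : c ≠ 0) : cappedRuler d (2 ^ d * c) = d := by
  have h := (padicValNat_dvd_iff_le (p := 2) (a := 2 ^ d * c) (n := d) (by positivity)).1
    (dvd_mul_right _ _)
  exact min_eq_right (by omega)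

theorem intercalate_replicate_succ_succ {α : Type*} (s l : List α) (m : ℕ) :
    s.intercalate (List.replicate (m + 2) l) =
      s.intercalate (List.replicate (m + 1) l) ++ s ++ l := by
  have hcons (n : ℕ) : s.intercalate (List.replicate (n + 2) l) =
      l ++ s ++ s.intercalate (List.replicate (n + 1) l) := by
    rw [List.replicate_succ, List.intercalate_cons_of_ne_nil (by simp)]
  induction m with
  | zero => simp [List.replicate_succ, List.intercalate]
  | succ m ih =>
    rw [hcons (m + 1)]
    conv_rhs => rw [hcons m]
    rw [ih]
    simp only [List.append_assoc]

theorem map_natAbs_gray_chain (d m : ℕ) :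
    (List.intercalate [(d : ℤ)] (List.replicate (m + 1) (gray d))).map Int.natAbs =
      (List.range (2 ^ d * (m + 1) - 1)).map fun i => cappedRuler d (i + 1) := by
  induction m with
  | zero => simpa [List.intercalate] using map_natAbs_gray_eq_cappedRuler d
  | succ m ih =>
    have hpos : 0 < 2 ^ d := by positivity
    have hpos' : 0 < 2 ^ d * (m + 1) := by positivity
    have hN : 2 ^ d * (m + 1 + 1) - 1 = (2 ^ d * (m + 1) - 1) + 1 + (2 ^ d - 1) := by
      rw [mul_add_one (2 ^ d) (m + 1)]; omega
    rw [intercalate_replicate_succ_succ, List.map_append, List.map_append, ih,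
      map_natAbs_gray_eq_cappedRuler, hN, List.range_add, List.range_add]
    simp only [List.map_append, List.map_map]
    congr 1
    · simp [Nat.sub_add_cancel hpos', cappedRuler_two_pow_mul]
    · refine List.map_congr_left fun i hi => ?_
      rw [List.mem_range] at hi
      rw [← cappedRuler_add_two_pow
        (Nat.not_dvd_of_pos_of_lt (by omega) (by omega) : ¬ 2 ^ d ∣ i + 1) (m + 1),
        Function.comp_apply]
      congr 1
      omega

theorem exists_dvd_mem_Ico (a : ℕ) {n : ℕ} (hn : 0 < n) : ∃ x ∈ Finset.Ico a (a + n), n ∣ x := by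
  refine ⟨n * ((a + n - 1) / n), ?_, dvd_mul_right _ _⟩
  have h₁ := Nat.div_add_mod (a + n - 1) n
  have h₂ := Nat.mod_lt (a + n - 1) hn
  rw [Finset.mem_Ico]
  omega

theorem eq_of_dvd_of_mem_Ico {a n x y : ℕ} (hx : x ∈ Finset.Ico a (a + n))
    (hy : y ∈ Finset.Ico a (a + n)) (hnx : n ∣ x) (hny : n ∣ y) : x = y := by
  rw [Finset.mem_Ico] at hx hy
  exact Nat.ModEq.eq_of_abs_lt
    ((Nat.modEq_zero_iff_dvd.2 hnx).trans (Nat.modEq_zero_iff_dvd.2 hny).symm)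
    (by rw [abs_lt]; omega)

theorem exists_padicValNat_two_eq_mem_Ico {a j k : ℕ} (ha : 0 < a) (hj : j < k) :
    ∃ x ∈ Finset.Ico a (a + 2 ^ k), padicValNat 2 x = j := by
  obtain ⟨y, hy, hdvd⟩ := exists_dvd_mem_Ico a (show 0 < 2 ^ k by positivity)
  rw [Finset.mem_Ico] at hy
  have hjk : 2 ^ j < 2 ^ k := Nat.pow_lt_pow_right one_lt_two hj
  have hlt : 2 ^ j < 2 ^ (j + 1) := Nat.pow_lt_pow_right one_lt_two j.lt_succ_self
  have key : ∀ z, 2 ^ k ∣ z → padicValNat 2 (z + 2 ^ j) = j := fun z hz => by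
    rw [padicValNat_two_eq_iff (by positivity),
      Nat.dvd_add_right ((pow_dvd_pow 2 hj.le).trans hz),
      Nat.dvd_add_right ((pow_dvd_pow 2 hj).trans hz)]
    exact ⟨dvd_rfl, Nat.not_dvd_of_pos_of_lt (by positivity) hlt⟩
  by_cases h : y + 2 ^ j < a + 2 ^ k
  · exact ⟨y + 2 ^ j, Finset.mem_Ico.2 (by omega), key y hdvd⟩
  · have := Nat.le_of_dvd (by omega) hdvd
    exact ⟨y - 2 ^ k + 2 ^ j, Finset.mem_Ico.2 (by omega),
      key _ (Nat.dvd_sub hdvd dvd_rfl)⟩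

theorem card_image_cappedRuler_Ico {a d k : ℕ} (ha : 0 < a) (hk : k < d) :
    ((Finset.Ico a (a + 2 ^ k)).image (cappedRuler d)).card = k + 1 := by
  obtain ⟨y, hy, hdvd⟩ := exists_dvd_mem_Ico a (show 0 < 2 ^ k by positivity)
  have hky : k < cappedRuler d y :=
    cappedRuler_of_dvd (ha.trans_le (Finset.mem_Ico.1 hy).1).ne' hk hdvd
  have himage : (Finset.Ico a (a + 2 ^ k)).image (cappedRuler d) =
      insert (cappedRuler d y) (Finset.Icc 1 k) := by
    ext v
    simp only [Finset.mem_image, Finset.mem_insert]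
    constructor
    · rintro ⟨x, hx, rfl⟩
      by_cases hxd : 2 ^ k ∣ x
      · exact .inl (by rw [eq_of_dvd_of_mem_Ico hx hy hxd hdvd])
      · obtain ⟨h₁, h₂⟩ := cappedRuler_of_not_dvd hk.le hxd
        exact .inr (Finset.mem_Icc.2 (by omega))
    · rintro (rfl | hv)
      · exact ⟨y, hy, rfl⟩
      · rw [Finset.mem_Icc] at hv
        obtain ⟨x, hx, hxv⟩ :=
          exists_padicValNat_two_eq_mem_Ico (j := v - 1) (k := k) ha (by omega)
        refine ⟨x, hx, ?_⟩
        rw [cappedRuler, hxv, min_eq_left (by omega)]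
        omega
  rw [himage, Finset.card_insert_of_notMem (by simp [hky]), Nat.card_Icc, Nat.add_sub_cancel]

theorem exists_toFinset_eq_image_Ico_of_infix {α : Type*} [DecidableEq α] {f : ℕ → α} {N : ℕ}
    {L : List α} (h : L <:+: (List.range N).map f) :
    ∃ a, L.toFinset = (Finset.Ico a (a + L.length)).image f := by
  obtain ⟨s, t, hst⟩ := h
  have hlen := congrArg List.length hst
  simp only [List.length_append, List.length_map, List.length_range] at hlen
  have hL : L = (List.range' s.length L.length).map f := by
    refine List.ext_getElem (by simp) fun i hi _ => ?_
    have hget : (s ++ L ++ t)[s.length + i]'(by simp; omega) = L[i] := by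
      simp [hi]
    simp only [hst] at hget
    simpa using hget.symm
  refine ⟨s.length, ?_⟩
  ext v
  rw [List.mem_toFinset, hL]
  simp

/-- For every `d ≥ 2` and `m ≥ 1`, the chain of `m` copies of `G(d)` mutually connected
by the single edge `⟨d⟩` is `(d−1)`-hyper-orthogonal. -/
theorem gray_chain_hyperOrthogonal (d m : ℕ) (hd : 2 ≤ d) (hm : 1 ≤ m) :
    HyperOrthogonal (d - 1) (List.intercalate [(d : ℤ)] (List.replicate m (gray d))) := by
  obtain ⟨m, rfl⟩ := Nat.exists_eq_add_of_le' hm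
  intro k _ hk L hL hlen
  have hmap := hL.map Int.natAbs
  rw [map_natAbs_gray_chain] at hmap
  obtain ⟨a, ha⟩ := exists_toFinset_eq_image_Ico_of_infix hmap
  have hshift : (Finset.Ico a (a + 2 ^ k)).image (fun i => cappedRuler d (i + 1)) =
      (Finset.Ico (a + 1) (a + 1 + 2 ^ k)).image (cappedRuler d) := by
    rw [add_right_comm, ← Finset.image_add_right_Ico, Finset.image_image]
    rfl
  rw [ha, List.length_map, hlen, hshift, card_image_cappedRuler_Ico a.succ_pos (by omega)]
end

section
/- The normalized Hilbert substitution is space-filling: let T be the substitution on the digiset {±1, ±2, ±3, ±4} defined by T(1) = ⟨1, 2, −3, 4⟩, T(2) = ⟨2, 1, −4, 3⟩, T(3) = ⟨−2, −1, 4, 2⟩, T(4) = ⟨−1, −2, 3, 1⟩, and T(−x) = −T(x) (entrywise negation). Let W_k = T^k⟨1⟩ be the k-fold image of the one-entry list ⟨1⟩, a list of length 4^k, and let π collapse digits by π(±3) = ±1, π(±4) = ±2, π(±1) = ±1, π(±2) = ±2. Define points p_0, p_1, …, p_{4^k−1} in ℤ² by p_0 = (0,0) and p_m = p_{m−1} +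 sgn(h_m)·e_{|h_m|}, where h_1, h_2, … are the entries of π(W_k) (applied entrywise) and e_1, e_2 are the standard basis vectors. Then for every k ≥ 1 the map m ↦ p_m is a bijection from {0, 1, …, 4^k − 1} onto the square grid {0, 1, …, 2^k − 1}². -/
/-- The normalized Hilbert substitution on positive digits:
`T(1) = ⟨1, 2, −3, 4⟩`, `T(2) = ⟨2, 1, −4, 3⟩`, `T(3) = ⟨−2, −1, 4, 2⟩`,
`T(4) = ⟨−1, −2, 3, 1⟩`. -/
def hilbTpos : ℕ → List ℤ
  | 1 => [1, 2, -3, 4]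
  | 2 => [2, 1, -4, 3]
  | 3 => [-2, -1, 4, 2]
  | 4 => [-1, -2, 3, 1]
  | _ => []

/-- The substitution `T` on the digiset `{±1, ±2, ±3, ±4}`, with `T(−x) = −T(x)`. -/
def hilbT (x : ℤ) : List ℤ :=
  if 0 < x then hilbTpos x.natAbs else (hilbTpos x.natAbs).map (fun y => -y)

/-- `W_k = T^k⟨1⟩`, the `k`-fold image of the one-entry list `⟨1⟩`, of length `4^k`. -/
def hilbW (k : ℕ) : List ℤ := (fun L => L.flatMap hilbT)^[k] [1]

/-- The digit-collapsing map `π`: `π(±3) = ±1`, `π(±4) = ±2`, `π(±1) = ±1`, `π(±2) = ±2`. -/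
def hilbCollapse (x : ℤ) : ℤ :=
  if x.natAbs = 3 then Int.sign x
  else if x.natAbs = 4 then 2 * Int.sign x
  else x

/-- The unit step in `ℤ²` associated with a digit `x ∈ {±1, ±2}`: `sgn(x)·e_{|x|}`. -/
def hilbStep (x : ℤ) : ℤ × ℤ :=
  (if x.natAbs = 1 then Int.sign x else 0, if x.natAbs = 2 then Int.sign x else 0)

/-- `p_m`, the partial sum of the first `m` steps of `π(W_k)`, starting at `p_0 = (0,0)`. -/
def hilbPt (k m : ℕ) : ℤ × ℤ := ((((hilbW k).map hilbCollapse).take m).map hilbStep).sum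

/-- The total displacement of the path whose steps are the collapsed entries of `L`. -/
def hilbDisp (L : List ℤ) : ℤ × ℤ := (L.map fun x => hilbStep (hilbCollapse x)).sum

/-- The path of `L`, started at the origin, visits `p` before its last step. -/
def HilbVisits (L : List ℤ) (p : ℤ × ℤ) : Prop := ∃ m < L.length, hilbDisp (L.take m) = p

/-- The `k`-fold image of a list under the Hilbert substitution. -/
def hilbIter (k : ℕ) (L : List ℤ) : List ℤ := (fun L => L.flatMap hilbT)^[k] L

theorem hilbDisp_append (L M : List ℤ) : hilbDisp (L ++ M) = hilbDisp L + hilbDisp M := by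
  simp [hilbDisp]

theorem hilbStep_collapse_neg (x : ℤ) :
    hilbStep (hilbCollapse (-x)) = -hilbStep (hilbCollapse x) := by
  unfold hilbCollapse hilbStep
  ext <;> simp only [Int.natAbs_neg, Int.sign_neg, Prod.fst_neg, Prod.snd_neg] <;>
    split_ifs <;> simp_all

theorem hilbDisp_map_neg (L : List ℤ) : hilbDisp (L.map fun x => -x) = -hilbDisp L := by
  induction L with
  | nil => simp [hilbDisp]
  | cons a L ih =>
    simp only [hilbDisp, List.map_cons, List.sum_cons, hilbStep_collapse_neg] at ih ⊢
    rw [ih]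
    abel

theorem hilbVisits_append {L M : List ℤ} {p : ℤ × ℤ} :
    HilbVisits (L ++ M) p ↔ HilbVisits L p ∨ HilbVisits M (p - hilbDisp L) := by
  constructor
  · rintro ⟨m, hm, rfl⟩
    rcases lt_or_ge m L.length with h | h
    · exact .inl ⟨m, h, by rw [List.take_append_of_le_length h.le]⟩
    · refine .inr ⟨m - L.length, by rw [List.length_append] at hm; omega, ?_⟩
      rw [List.take_append, List.take_of_length_le h, hilbDisp_append]
      abel
  · rintro (⟨m, hm, rfl⟩ | ⟨m, hm, h⟩)
    · exact ⟨m, by rw [List.length_append]; omega, by rw [List.take_append_of_le_length hm.le]⟩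
    · refine ⟨L.length + m, by rw [List.length_append]; omega, ?_⟩
      rw [List.take_length_add_append, hilbDisp_append, h]
      abel

theorem HilbVisits.map_neg {L : List ℤ} {p : ℤ × ℤ} (h : HilbVisits L p) :
    HilbVisits (L.map fun x => -x) (-p) := by
  obtain ⟨m, hm, rfl⟩ := h
  exact ⟨m, by simpa using hm, by rw [← List.map_take, hilbDisp_map_neg]⟩

theorem hilbIter_append (k : ℕ) (L M : List ℤ) :
    hilbIter k (L ++ M) = hilbIter k L ++ hilbIter k M := by
  induction k generalizing L M with
  | zero => rfl
  | succ k ih => simpa [hilbIter] using ih _ _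

theorem hilbT_neg (x : ℤ) : hilbT (-x) = (hilbT x).map fun y => -y := by
  unfold hilbT
  rcases lt_trichotomy x 0 with h | rfl | h
  · simp [h, h.not_gt]
  · simp [hilbTpos]
  · simp [h, h.not_gt]

theorem hilbIter_map_neg (k : ℕ) (L : List ℤ) :
    hilbIter k (L.map fun x => -x) = (hilbIter k L).map fun x => -x := by
  induction k generalizing L with
  | zero => rfl
  | succ k ih =>
    simp only [hilbIter, Function.iterate_succ_apply] at ih ⊢
    rw [← ih, List.flatMap_map, List.map_flatMap]
    simp only [hilbT_neg]

theorem hilbIter_cons_cons (k : ℕ) (a b : ℤ) (L : List ℤ) :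
    hilbIter k (a :: b :: L) = hilbIter k [a] ++ hilbIter k (b :: L) := by
  rw [← hilbIter_append, List.singleton_append]

theorem hilbIter_neg (k : ℕ) (a : ℤ) : hilbIter k [-a] = (hilbIter k [a]).map fun x => -x := by
  rw [← hilbIter_map_neg, List.map_singleton]

theorem hilbIter_succ_one (k : ℕ) : hilbIter (k + 1) [1] =
    hilbIter k [1] ++ (hilbIter k [2] ++ ((hilbIter k [3]).map (fun x => -x) ++
      hilbIter k [4])) := by
  simp only [← hilbIter_neg, ← hilbIter_cons_cons]
  rfl

theorem hilbIter_succ_two (k : ℕ) : hilbIter (k + 1) [2] =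
    hilbIter k [2] ++ (hilbIter k [1] ++ ((hilbIter k [4]).map (fun x => -x) ++
      hilbIter k [3])) := by
  simp only [← hilbIter_neg, ← hilbIter_cons_cons]
  rfl

theorem hilbIter_succ_three (k : ℕ) : hilbIter (k + 1) [3] =
    (hilbIter k [2]).map (fun x => -x) ++ ((hilbIter k [1]).map (fun x => -x) ++
      (hilbIter k [4] ++ hilbIter k [2])) := by
  simp only [← hilbIter_neg, ← hilbIter_cons_cons]
  rfl

theorem hilbIter_succ_four (k : ℕ) : hilbIter (k + 1) [4] =
    (hilbIter k [1]).map (fun x => -x) ++ ((hilbIter k [2]).map (fun x => -x) ++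
      (hilbIter k [3] ++ hilbIter k [1])) := by
  simp only [← hilbIter_neg, ← hilbIter_cons_cons]
  rfl

theorem length_hilbIter (k : ℕ) :
    (hilbIter k [1]).length = 4 ^ k ∧ (hilbIter k [2]).length = 4 ^ k ∧
      (hilbIter k [3]).length = 4 ^ k ∧ (hilbIter k [4]).length = 4 ^ k := by
  induction k with
  | zero => simp [hilbIter]
  | succ k ih =>
    simp only [hilbIter_succ_one, hilbIter_succ_two, hilbIter_succ_three, hilbIter_succ_four,
      List.length_append, List.length_map, ih]
    omega

/-- The two alternatives are the even and the odd iterates. -/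
theorem hilbDisp_hilbIter (k : ℕ) :
    (hilbDisp (hilbIter k [1]) = (2 ^ k, 0) ∧ hilbDisp (hilbIter k [2]) = (0, 2 ^ k) ∧
      hilbDisp (hilbIter k [3]) = (1, 1 - 2 ^ k) ∧ hilbDisp (hilbIter k [4]) = (1 - 2 ^ k, 1)) ∨
    (hilbDisp (hilbIter k [1]) = (0, 2 ^ k) ∧ hilbDisp (hilbIter k [2]) = (2 ^ k, 0) ∧
      hilbDisp (hilbIter k [3]) = (1 - 2 ^ k, 1) ∧
      hilbDisp (hilbIter k [4]) = (1, 1 - 2 ^ k)) := by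
  induction k with
  | zero => left; decide
  | succ k ih =>
    simp only [hilbIter_succ_one, hilbIter_succ_two, hilbIter_succ_three, hilbIter_succ_four,
      hilbDisp_append, hilbDisp_map_neg]
    rcases ih with ⟨h1, h2, h3, h4⟩ | ⟨h1, h2, h3, h4⟩
    · right
      simp only [h1, h2, h3, h4, Prod.ext_iff, Prod.fst_add, Prod.snd_add, Prod.fst_neg,
        Prod.snd_neg, pow_succ]
      omega
    · left
      simp only [h1, h2, h3, h4, Prod.ext_iff, Prod.fst_add, Prod.snd_add, Prod.fst_neg,
        Prod.snd_neg, pow_succ]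
      omega

theorem hilbVisits_map_neg_iff {L : List ℤ} {p : ℤ × ℤ} :
    HilbVisits (L.map fun x => -x) p ↔ HilbVisits L (-p) :=
  ⟨fun h => by simpa using h.map_neg, fun h => by simpa using h.map_neg⟩

theorem hilbVisits_hilbIter (k : ℕ) :
    (∀ x y : ℤ, 0 ≤ x ∧ x < 2 ^ k ∧ 0 ≤ y ∧ y < 2 ^ k → HilbVisits (hilbIter k [1]) (x, y)) ∧
    (∀ x y : ℤ, 0 ≤ x ∧ x < 2 ^ k ∧ 0 ≤ y ∧ y < 2 ^ k → HilbVisits (hilbIter k [2]) (x, y)) ∧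
    (∀ x y : ℤ, x ≤ 0 ∧ -2 ^ k < x ∧ y ≤ 0 ∧ -2 ^ k < y → HilbVisits (hilbIter k [3]) (x, y)) ∧
    (∀ x y : ℤ, x ≤ 0 ∧ -2 ^ k < x ∧ y ≤ 0 ∧ -2 ^ k < y →
      HilbVisits (hilbIter k [4]) (x, y)) := by
  induction k with
  | zero =>
    refine ⟨?_, ?_, ?_, ?_⟩ <;> intro x y h <;>
      exact ⟨0, by simp [hilbIter], by simp only [hilbDisp, Prod.ext_iff]; simp; omega⟩
  | succ k ih =>
    obtain ⟨v1, v2, v3, v4⟩ := ih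
    simp only [hilbIter_succ_one, hilbIter_succ_two, hilbIter_succ_three, hilbIter_succ_four,
      hilbVisits_append, hilbDisp_map_neg, hilbVisits_map_neg_iff, pow_succ]
    rcases hilbDisp_hilbIter k with ⟨h1, h2, h3, h4⟩ | ⟨h1, h2, h3, h4⟩ <;>
    · simp only [h1, h2, h3, h4, Prod.mk_sub_mk, Prod.neg_mk]
      generalize (2 : ℤ) ^ k = N at *
      refine ⟨?_, ?_, ?_, ?_⟩ <;> intro x y hxy <;> by_contra! h <;> obtain ⟨a, b, c, d⟩ := h
      · have := mt (v1 _ _) a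
        have := mt (v2 _ _) b
        have := mt (v3 _ _) c
        have := mt (v4 _ _) d
        omega
      · have := mt (v2 _ _) a
        have := mt (v1 _ _) b
        have := mt (v4 _ _) c
        have := mt (v3 _ _) d
        omega
      · have := mt (v2 _ _) a
        have := mt (v1 _ _) b
        have := mt (v4 _ _) c
        have := mt (v2 _ _) d
        omega
      · have := mt (v1 _ _) a
        have := mt (v2 _ _) b
        have := mt (v3 _ _) c
        have := mt (v1 _ _) d
        omega

/-- **The normalized Hilbert substitution is space-filling**: for every `k ≥ 1`, the map
`m ↦ p_m` is a bijection from `{0, 1, …, 4^k − 1}` onto the square grid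
`{0, 1, …, 2^k − 1}²`. -/
theorem hilbert_space_filling (k : ℕ) (hk : 1 ≤ k) :
    Set.BijOn (hilbPt k) (Set.Iio (4 ^ k))
      {p : ℤ × ℤ | 0 ≤ p.1 ∧ p.1 < 2 ^ k ∧ 0 ≤ p.2 ∧ p.2 < 2 ^ k} := by
  set grid : Finset (ℤ × ℤ) := Finset.Ico 0 (2 ^ k) ×ˢ Finset.Ico 0 (2 ^ k) with hgrid
  have hsub : grid ⊆ (Finset.range (4 ^ k)).image (hilbPt k) := by
    rintro ⟨x, y⟩ h
    simp only [hgrid, Finset.mem_product, Finset.mem_Ico] at h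
    obtain ⟨m, hm, hp⟩ := (hilbVisits_hilbIter k).1 x y ⟨h.1.1, h.1.2, h.2.1, h.2.2⟩
    rw [(length_hilbIter k).1] at hm
    refine Finset.mem_image.2 ⟨m, Finset.mem_range.2 hm, ?_⟩
    rw [← hp]
    simp [hilbPt, hilbDisp, hilbW, hilbIter, List.map_take, Function.comp_def]
  have hcard : grid.card = 4 ^ k := by
    have h : ((2 : ℤ) ^ k).toNat = 2 ^ k := by rw [Int.toNat_pow_of_nonneg (by norm_num)]; rfl
    rw [hgrid, Finset.card_product, Int.card_Ico, sub_zero, h, ← mul_pow]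
    norm_num
  have himage : grid = (Finset.range (4 ^ k)).image (hilbPt k) :=
    Finset.eq_of_subset_of_card_le hsub <| by
      simpa [hcard] using Finset.card_image_le (s := Finset.range (4 ^ k)) (f := hilbPt k)
  have hinj : Set.InjOn (hilbPt k) (Finset.range (4 ^ k)) :=
    Finset.injOn_of_card_image_eq (by rw [← himage, hcard, Finset.card_range])
  have hbij := hinj.bijOn_image
  rw [← Finset.coe_image, ← himage, Finset.coe_range] at hbij
  convert hbij using 1
  ext p
  simp [hgrid, and_assoc]
end
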